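/- arXiv:2409.20546 — 2 statements merged into one kernel-verified Lean document; each statement's English description precedes it below -/
import Mathlib

section
/- Let (P_t)_{t≥0} be the family of operators P_t f(x) = ∫_ℝ f(u + x e^{-t}) F_{X_{(t)}}(du), where F_{X_{(t)}} is the probability law with characteristic function φ_t(y) = φ_bg(y)/φ_bg(e^{-t} y). Then P_0 f = f, lim_{t→∞} P_t f(x) = E[f(X)] for bounded continuous f, and P_t ∘ P_s = P_{t+s} for all s, t ≥ 0. -/
open MeasureTheory Filter

/-- Characteristic function of the bilateral gamma distribution `BG(α₁, p₁, α₂, p₂)`. -/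
noncomputable def bgCharFun (α₁ p₁ α₂ p₂ : ℝ) (z : ℝ) : ℂ :=
  ((α₁ : ℂ) / (α₁ - z * Complex.I)) ^ (p₁ : ℂ)
    * ((α₂ : ℂ) / (α₂ + z * Complex.I)) ^ (p₂ : ℂ)

/-- **Semigroup properties of the bilateral gamma Mehler-type semigroup.**
Let `μ t` be the law of `X_{(t)}`, with characteristic function `φ_t(y) = φ_bg(y)/φ_bg(e^{-t}y)`,
and let `P_t f(x) = ∫ f(u + x e^{-t}) μ_t(du)`.  Then `P_0 f = f`,
`P_t f(x) → E[f(X)]` as `t → ∞` for bounded continuous `f`, and `P_t ∘ P_s = P_{t+s}`. -/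
theorem bg_semigroup_properties {Ω : Type*} [MeasurableSpace Ω]
    (P : Measure Ω) [IsProbabilityMeasure P]
    (α₁ α₂ p₁ p₂ : ℝ) (hα₁ : 0 < α₁) (hα₂ : 0 < α₂) (hp₁ : 0 < p₁) (hp₂ : 0 < p₂)
    (X : Ω → ℝ) (hX : Measurable X)
    (hXlaw : ∀ z : ℝ, ∫ ω, Complex.exp (Complex.I * z * X ω) ∂P = bgCharFun α₁ p₁ α₂ p₂ z)
    (μ : ℝ → Measure ℝ) (hμ : ∀ t, IsProbabilityMeasure (μ t))
    (hμchar : ∀ t : ℝ, 0 ≤ t → ∀ y : ℝ,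
      ∫ x, Complex.exp (Complex.I * y * x) ∂(μ t)
        = bgCharFun α₁ p₁ α₂ p₂ y / bgCharFun α₁ p₁ α₂ p₂ (Real.exp (-t) * y)) :
    (∀ f : BoundedContinuousFunction ℝ ℝ, ∀ x : ℝ,
        ∫ u, f (u + x * Real.exp (-(0 : ℝ))) ∂(μ 0) = f x) ∧
    (∀ f : BoundedContinuousFunction ℝ ℝ, ∀ x : ℝ,
        Tendsto (fun t : ℝ => ∫ u, f (u + x * Real.exp (-t)) ∂(μ t)) atTop
          (nhds (∫ ω, f (X ω) ∂P))) ∧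
    (∀ f : BoundedContinuousFunction ℝ ℝ, ∀ s t : ℝ, 0 ≤ s → 0 ≤ t → ∀ x : ℝ,
        ∫ u, (∫ v, f (v + (u + x * Real.exp (-t)) * Real.exp (-s)) ∂(μ s)) ∂(μ t)
          = ∫ u, f (u + x * Real.exp (-(t + s))) ∂(μ (t + s))) := by
  have hφ : ∀ z, bgCharFun α₁ p₁ α₂ p₂ z ≠ 0 := by
    intro z
    have h1 : (α₁ : ℂ) - z * Complex.I ≠ 0 := by
      intro h
      have := congrArg Complex.re h
      simp at this
      exact hα₁.ne' this
    have h2 : (α₂ : ℂ) + z * Complex.I ≠ 0 := by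
      intro h
      have := congrArg Complex.re h
      simp at this
      exact hα₂.ne' this
    have h3 : (α₁ : ℂ) ≠ 0 := by exact_mod_cast hα₁.ne'
    have h4 : (α₂ : ℂ) ≠ 0 := by exact_mod_cast hα₂.ne'
    unfold bgCharFun
    refine mul_ne_zero ?_ ?_
    · rw [Ne, Complex.cpow_eq_zero_iff]
      exact fun h => div_ne_zero h3 h1 h.1
    · rw [Ne, Complex.cpow_eq_zero_iff]
      exact fun h => div_ne_zero h4 h2 h.1
  have hXp : IsProbabilityMeasure (P.map X) := Measure.isProbabilityMeasure_map hX.aemeasurable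
  have hcX : ∀ z, charFun (P.map X) z = bgCharFun α₁ p₁ α₂ p₂ z := by
    intro z
    rw [charFun_apply_real, integral_map hX.aemeasurable (by fun_prop), ← hXlaw]
    refine integral_congr_ae (Eventually.of_forall fun ω => ?_)
    simp only
    congr 1
    ring
  have hc : ∀ t, 0 ≤ t → ∀ y, charFun (μ t) y
      = bgCharFun α₁ p₁ α₂ p₂ y / bgCharFun α₁ p₁ α₂ p₂ (Real.exp (-t) * y) := by
    intro t ht y
    rw [charFun_apply_real, ← hμchar t ht]
    refine integral_congr_ae (Eventually.of_forall fun ω => ?_)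
    simp only
    congr 1
    ring
  generalize bgCharFun α₁ p₁ α₂ p₂ = φ at hφ hcX hc
  have hφc : Continuous φ := by
    have : φ = charFun (P.map X) := (funext hcX).symm
    rw [this]
    exact continuous_charFun
  have hφ0 : φ 0 = 1 := by
    rw [← hcX]; simp
  refine ⟨?_, ?_, ?_⟩
  · intro f x
    have h0 : μ 0 = Measure.dirac 0 := by
      apply Measure.ext_of_charFun
      ext y
      rw [hc 0 le_rfl, charFun_dirac]
      simp [hφ y]
    rw [h0, integral_dirac]
    simp
  · intro f x
    let ν : ℝ → ProbabilityMeasure ℝ := fun t =>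
      ⟨(μ t).map (· + x * Real.exp (-t)), Measure.isProbabilityMeasure_map (by fun_prop)⟩
    let ν₀ : ProbabilityMeasure ℝ := ⟨P.map X, hXp⟩
    have hexp : Tendsto (fun t : ℝ => Real.exp (-t)) atTop (nhds 0) :=
      Real.tendsto_exp_neg_atTop_nhds_zero
    have hchar : ∀ y, Tendsto (fun t => charFun (ν t : Measure ℝ) y) atTop
        (nhds (charFun (ν₀ : Measure ℝ) y)) := by
      intro y
      have e : (fun t => φ y / φ (Real.exp (-t) * y)
          * Complex.exp (((x * Real.exp (-t) * y : ℝ) : ℂ) * Complex.I)) =ᶠ[atTop]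
          (fun t => charFun (ν t : Measure ℝ) y) := by
        filter_upwards [eventually_ge_atTop 0] with t ht
        change _ = charFun ((μ t).map (· + x * Real.exp (-t))) y
        rw [charFun_map_add_const, hc t ht]
        simp [mul_comm, mul_left_comm]
      refine Tendsto.congr' e ?_
      change Tendsto _ _ (nhds (charFun (P.map X) y))
      rw [hcX]
      have h1 : Tendsto (fun t : ℝ => φ (Real.exp (-t) * y)) atTop (nhds 1) := by
        have h := (hφc.tendsto (0 * y)).comp (hexp.mul_const y)
        simpa [hφ0, Function.comp_def] using h
      have h2 : Tendsto (fun t : ℝ =>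
          Complex.exp (((x * Real.exp (-t) * y : ℝ) : ℂ) * Complex.I)) atTop (nhds 1) := by
        have hcont : Continuous (fun r : ℝ =>
          Complex.exp (((x * r * y : ℝ) : ℂ) * Complex.I)) := by fun_prop
        have h := (hcont.tendsto 0).comp hexp
        simpa [Function.comp_def] using h
      have h3 := ((tendsto_const_nhds (x := φ y)).div h1 one_ne_zero).mul h2
      simpa using h3
    have hint : ∀ t, ∫ u, f (u + x * Real.exp (-t)) ∂(μ t) = ∫ u, f u ∂(ν t : Measure ℝ) := by
      intro t
      change _ = ∫ u, f u ∂((μ t).map (· + x * Real.exp (-t)))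
      rw [integral_map (by fun_prop) (by fun_prop)]
    have hint0 : ∫ ω, f (X ω) ∂P = ∫ u, f u ∂(ν₀ : Measure ℝ) := by
      change _ = ∫ u, f u ∂(P.map X)
      rw [integral_map hX.aemeasurable (by fun_prop)]
    simp_rw [hint, hint0]
    apply tendsto_of_seq_tendsto
    intro u hu
    have hL : Tendsto (fun n => ν (u n)) atTop (nhds ν₀) :=
      ProbabilityMeasure.tendsto_of_tendsto_charFun (fun y => (hchar y).comp hu)
    exact (ProbabilityMeasure.tendsto_iff_forall_integral_tendsto.1 hL) f
  · intro f s t hs ht x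
    have hp : IsProbabilityMeasure ((μ t).map (Real.exp (-s) * ·)) :=
      Measure.isProbabilityMeasure_map (by fun_prop)
    have hm : μ (t + s) = ((μ t).map (Real.exp (-s) * ·)).conv (μ s) := by
      apply Measure.ext_of_charFun
      ext y
      rw [charFun_conv, charFun_map_mul, hc _ ht, hc _ hs, hc _ (add_nonneg ht hs)]
      have : Real.exp (-(t + s)) * y = Real.exp (-t) * (Real.exp (-s) * y) := by
        rw [neg_add, Real.exp_add]; ring
      rw [this]
      have := hφ (Real.exp (-s) * y)
      have := hφ (Real.exp (-t) * (Real.exp (-s) * y))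
      field_simp
    rw [hm, integral_conv, integral_map (by fun_prop)]
    · refine integral_congr_ae (Eventually.of_forall fun u => ?_)
      refine integral_congr_ae (Eventually.of_forall fun v => ?_)
      simp only
      congr 1
      rw [neg_add, Real.exp_add]; ring
    · apply StronglyMeasurable.aestronglyMeasurable
      apply StronglyMeasurable.integral_prod_right (f := fun p v => f (p + v + x * Real.exp (-(t+s))))
      apply Continuous.stronglyMeasurable
      simp only [Function.uncurry_def]
      fun_prop
    · exact (f.compContinuous ⟨fun u => u + x * Real.exp (-(t+s)), by fun_prop⟩).integrable _
end

section
/- Let G ∈ D^{2,4}, X ~ BG(α₁, p₁, α₂, p₂) with α₁α₂ > 1 + |α₁ - α₂|, α₁₂ = α₁α₂/(α₁α₂ - (1+|α₁-α₂|)) and α₁₃ = 1/α₁ - 1/α₂. Then d₃(G, X) ≤ (α₁₂/3)·E| G/(α₁α₂) + α₁₃ Γ₂(G) - Γ₃(G) | + (α₁₂/2)·| (p₁+p₂)/(α₁α₂) + α₁₃ E(G) - E(Γ₂(G)) | + α₁₂·| E(X) - E(G) |. -/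
open MeasureTheory ProbabilityTheory

/-- The class `W_r` of `r`-times differentiable functions `h : ℝ → ℝ` with
`‖h^{(k)}‖_∞ ≤ 1` for `k = 0, 1, …, r`. -/
def smoothClass (r : ℕ) : Set (ℝ → ℝ) :=
  {h | (∀ k < r, Differentiable ℝ (iteratedDeriv k h)) ∧
    ∀ k ≤ r, ∀ x : ℝ, |iteratedDeriv k h x| ≤ 1}

/-- The smooth Wasserstein distance `d_r(Y, Z) = sup_{h ∈ W_r} |E h(Y) - E h(Z)|`. -/
noncomputable def dSmooth {Ω : Type*} [MeasurableSpace Ω] (P : Measure Ω)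
    (Y Z : Ω → ℝ) (r : ℕ) : ℝ :=
  sSup {d | ∃ h ∈ smoothClass r, d = |(∫ ω, h (Y ω) ∂P) - ∫ ω, h (Z ω) ∂P|}

lemma bg_gpdf_int {a r : ℝ} (ha : 0 < a) (hr : 0 < r) :
    Integrable (gammaPDFReal a r) ∧ ∫ x, gammaPDFReal a r x = 1 := by
  have h := lintegral_gammaPDF_eq_one ha hr
  have h1 : Integrable (gammaPDFReal a r) := by
    refine ⟨(measurable_gammaPDFReal a r).aestronglyMeasurable, ?_⟩
    rw [hasFiniteIntegral_iff_ofReal (ae_of_all _ (gammaPDFReal_nonneg ha hr))]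
    unfold gammaPDF at h
    rw [h]; simp
  refine ⟨h1, ?_⟩
  rw [integral_eq_lintegral_of_nonneg_ae (ae_of_all _ (gammaPDFReal_nonneg ha hr)) h1.1]
  unfold gammaPDF at h
  rw [h]; simp

lemma bg_gamma_integrable_iff {E : Type*} [NormedAddCommGroup E] [NormedSpace ℝ E] {a r : ℝ}
    (ha : 0 < a) (hr : 0 < r) (f : ℝ → E) :
    Integrable f (gammaMeasure a r) ↔ Integrable (fun x => gammaPDFReal a r x • f x) := by
  unfold gammaMeasure
  rw [integrable_withDensity_iff_integrable_smul' (by unfold gammaPDF; fun_prop) (by simp [gammaPDF])]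
  simp [gammaPDF, ENNReal.toReal_ofReal, gammaPDFReal_nonneg ha hr]

lemma bg_gamma_integral {E : Type*} [NormedAddCommGroup E] [NormedSpace ℝ E] {a r : ℝ}
    (ha : 0 < a) (hr : 0 < r) (f : ℝ → E) :
    ∫ x, f x ∂(gammaMeasure a r) = ∫ x, gammaPDFReal a r x • f x := by
  unfold gammaMeasure
  rw [integral_withDensity_eq_integral_toReal_smul (by unfold gammaPDF; fun_prop) (by simp [gammaPDF])]
  simp [gammaPDF, ENNReal.toReal_ofReal, gammaPDFReal_nonneg ha hr]

lemma bg_gpdf_mul_x {a r : ℝ} (ha : 0 < a) (hr : 0 < r) (x : ℝ) :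
    gammaPDFReal a r x • x = a / r * gammaPDFReal (a+1) r x := by
  unfold gammaPDFReal
  split_ifs with h
  · rcases h.eq_or_lt with rfl | h
    · simp [Real.zero_rpow ha.ne']
    · rw [Real.Gamma_add_one ha.ne', Real.rpow_add_one hr.ne', show a + 1 - 1 = (a - 1) + 1 by ring,
        Real.rpow_add_one h.ne']
      have := Real.Gamma_pos_of_pos ha
      simp only [smul_eq_mul]
      field_simp
  · simp

lemma bg_gpdf_mul_exp {a r t : ℝ} (hr : 0 < r) (ht : t < r) (x : ℝ) :
    gammaPDFReal a r x • Real.exp (t * x) = (r / (r - t)) ^ a * gammaPDFReal a (r - t) x := by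
  have : 0 < r - t := by linarith
  unfold gammaPDFReal
  split_ifs with h
  · rw [Real.div_rpow hr.le this.le, show -((r - t) * x) = -(r*x) + t * x by ring, Real.exp_add]
    have := Real.rpow_pos_of_pos this a
    simp only [smul_eq_mul]
    field_simp
  · simp

lemma bg_gamma_mean {a r : ℝ} (ha : 0 < a) (hr : 0 < r) :
    Integrable (fun x : ℝ => x) (gammaMeasure a r) ∧ ∫ x, x ∂(gammaMeasure a r) = a / r := by
  rw [bg_gamma_integrable_iff ha hr, bg_gamma_integral ha hr]
  simp_rw [bg_gpdf_mul_x ha hr]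
  have := bg_gpdf_int (a := a+1) (by linarith) hr
  refine ⟨this.1.const_mul _, ?_⟩
  rw [integral_const_mul, this.2, mul_one]

lemma bg_gamma_exp {a r t : ℝ} (ha : 0 < a) (hr : 0 < r) (ht : t < r) :
    Integrable (fun x : ℝ => Real.exp (t * x)) (gammaMeasure a r) ∧
      ∫ x, Real.exp (t * x) ∂(gammaMeasure a r) = (r / (r - t)) ^ a := by
  rw [bg_gamma_integrable_iff ha hr, bg_gamma_integral ha hr]
  simp_rw [bg_gpdf_mul_exp hr ht]
  have := bg_gpdf_int (a := a) (r := r - t) ha (by linarith)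
  refine ⟨this.1.const_mul _, ?_⟩
  rw [integral_const_mul, this.2, mul_one]

lemma bg_gamma_nonneg (a r : ℝ) : ∀ᵐ x ∂(gammaMeasure a r), 0 ≤ x := by
  rw [ae_iff]
  have : {x : ℝ | ¬ 0 ≤ x} = Set.Iio 0 := by ext; simp
  rw [this, gammaMeasure, withDensity_apply _ measurableSet_Iio]
  exact lintegral_gammaPDF_of_nonpos le_rfl

lemma bg_gamma_cexp {a r : ℝ} (ha : 0 < a) (hr : 0 < r) {z : ℂ} (hz : z.re < r) :
    ∫ x : ℝ, Complex.exp (z * x) ∂(gammaMeasure a r) = (1 - z / r) ^ (-(a : ℂ)) := by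
  set U : Set ℂ := {z | z.re < r} with hU
  have hUo : IsOpen U := isOpen_lt Complex.continuous_re continuous_const
  have hUc : IsPreconnected U := (convex_halfSpace_re_lt r).isPreconnected
  have hsub : ∀ z ∈ U, z.re ∈ interior (integrableExpSet id (gammaMeasure a r)) := by
    intro z hz
    have : Set.Iio r ⊆ integrableExpSet id (gammaMeasure a r) := fun t ht => (bg_gamma_exp ha hr ht).1
    exact interior_maximal this isOpen_Iio hz
  have h1 : AnalyticOnNhd ℂ (complexMGF id (gammaMeasure a r)) U := fun z hz =>
    analyticAt_complexMGF (hsub z hz)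
  have hre : ∀ z ∈ U, 0 < (1 - z / r : ℂ).re := by
    intro z hz
    have hz : z.re < r := hz
    simp only [Complex.sub_re, Complex.one_re, Complex.div_ofReal_re, sub_pos]
    rwa [div_lt_one hr]
  have h2 : AnalyticOnNhd ℂ (fun z : ℂ => (1 - z / r) ^ (-(a : ℂ))) U := by
    apply DifferentiableOn.analyticOnNhd _ hUo
    intro z hz
    apply DifferentiableAt.differentiableWithinAt
    apply DifferentiableAt.cpow_const (by fun_prop)
    exact Or.inl (hre z hz)
  have h3 := h1.eqOn_of_preconnected_of_frequently_eq h2 hUc (z₀ := 0) (by simpa [hU] using hr) ?_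
  · have := h3 hz
    simpa [complexMGF] using this
  · have hreal : ∀ t : ℝ, t < r → complexMGF id (gammaMeasure a r) t = (1 - (t:ℂ) / r) ^ (-(a : ℂ)) := by
      intro t ht
      rw [complexMGF_ofReal, mgf]
      simp only [id]
      rw [(bg_gamma_exp ha hr ht).2]
      have h0 : 0 < r - t := by linarith
      have : (1 - (t:ℂ)/r) = ((1 - t / r : ℝ) : ℂ) := by push_cast; rfl
      have h5 : 1 - t / r = (r - t) / r := by field_simp
      have h6 : (0:ℝ) ≤ (r-t)/r := by positivity
      rw [this, h5, ← Complex.ofReal_neg, ← Complex.ofReal_cpow h6, Real.rpow_neg h6, ← Real.inv_rpow h6, inv_div]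
    have ht : Filter.Tendsto (fun n : ℕ => ((-(1 / ((n:ℝ) + 1)) : ℝ) : ℂ)) Filter.atTop (nhdsWithin 0 {0}ᶜ) := by
      rw [tendsto_nhdsWithin_iff]
      constructor
      · have := (tendsto_one_div_add_atTop_nhds_zero_nat (𝕜 := ℝ)).neg
        have := (Complex.continuous_ofReal.tendsto _).comp this
        simpa [Function.comp_def] using this
      · refine Filter.Eventually.of_forall fun n => ?_
        have : (0:ℝ) < 1 / ((n:ℝ)+1) := by positivity
        simp only [Set.mem_compl_iff, Set.mem_singleton_iff, Complex.ofReal_eq_zero]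
        linarith
    apply ht.frequently
    refine Filter.Frequently.of_forall fun n => ?_
    have : (0:ℝ) < 1 / ((n:ℝ)+1) := by positivity
    exact hreal _ (by linarith)

noncomputable def bgPo : Kernel ℝ ℕ where
  toFun l := poissonMeasure l.toNNReal
  measurable' := by
    refine Measure.measurable_of_measurable_coe _ fun s hs => ?_
    have : ∀ l : ℝ, poissonMeasure l.toNNReal s = ∑' n : ℕ, ENNReal.ofReal
        (Real.exp (-(l.toNNReal : ℝ)) * (l.toNNReal : ℝ) ^ n / (n.factorial)) * (Measure.dirac n s) := by
      intro l
      rw [poissonMeasure, Measure.sum_apply _ hs]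
      simp
    simp_rw [this]
    fun_prop

instance : IsMarkovKernel bgPo := ⟨fun l => by change IsProbabilityMeasure (poissonMeasure _); infer_instance⟩

noncomputable def bgGa : Kernel ℕ ℝ where
  toFun n := if n = 0 then Measure.dirac 0 else gammaMeasure n 1
  measurable' := Measurable.of_discrete

instance : IsMarkovKernel bgGa := ⟨fun n => by
  change IsProbabilityMeasure (if n = 0 then Measure.dirac 0 else gammaMeasure n 1)
  split_ifs with h
  · infer_instance
  · exact isProbabilityMeasure_gammaMeasure (by positivity) one_pos⟩

lemma bgGa_cexp (n : ℕ) (τ : ℝ) :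
    ∫ x : ℝ, Complex.exp (τ * Complex.I * x) ∂(bgGa n) = (1 / (1 - τ * Complex.I)) ^ n := by
  change ∫ x : ℝ, _ ∂(if n = 0 then Measure.dirac 0 else gammaMeasure n 1) = _
  split_ifs with h
  · subst h; simp
  · rw [bg_gamma_cexp (by positivity) one_pos (by simp)]
    simp [Complex.cpow_neg]

lemma bg_norm_cexp (t : ℝ) : ‖Complex.exp (t * Complex.I)‖ = 1 := Complex.norm_exp_ofReal_mul_I t

lemma bg_intble {α : Type*} [MeasurableSpace α] (μ : Measure α) [IsFiniteMeasure μ] {f : α → ℂ}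
    (hf : Measurable f) (C : ℝ) (h : ∀ x, ‖f x‖ ≤ C) : Integrable f μ :=
  Integrable.of_bound hf.aestronglyMeasurable C (ae_of_all _ h)

lemma bg_nexp (τ x : ℝ) : ‖Complex.exp (τ * Complex.I * x)‖ ≤ 1 := by
  have : (τ * Complex.I * x : ℂ) = ((τ * x : ℝ) : ℂ) * Complex.I := by push_cast; ring
  rw [this, bg_norm_cexp]

noncomputable def bgS : Kernel ℝ ℝ := bgGa ∘ₖ bgPo

instance : IsMarkovKernel bgS := by unfold bgS; infer_instance

lemma bgS_cexp {l : ℝ} (hl : 0 ≤ l) (τ : ℝ) :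
    ∫ x : ℝ, Complex.exp (τ * Complex.I * x) ∂(bgS l) =
      Complex.exp ((1 / (1 - τ * Complex.I) - 1) * l) := by
  unfold bgS
  rw [Kernel.integral_comp (bg_intble _ (by fun_prop) 1 (bg_nexp τ))]
  simp_rw [bgGa_cexp]
  change ∫ n : ℕ, _ ∂(poissonMeasure _) = _
  rw [integral_poissonMeasure, Real.coe_toNNReal l hl]
  set y : ℂ := 1 / (1 - τ * Complex.I)
  have h := (NormedSpace.expSeries_div_hasSum_exp (l * y)).mul_left (Complex.exp (-l))
  rw [← Complex.exp_eq_exp_ℂ, ← Complex.exp_add] at h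
  rw [show (y - 1) * l = -l + l * y by ring, ← h.tsum_eq]
  congr 1; ext n
  rw [Complex.real_smul]; push_cast
  rw [mul_pow]; ring

noncomputable def bgL (p : ℝ) : Kernel ℝ ℝ :=
  (Kernel.id ×ₖ Kernel.const ℝ (gammaMeasure p 1)).map (fun q : ℝ × ℝ => (1 / q.1 - 1) * q.2)

noncomputable def bgZ (p : ℝ) : Kernel ℝ ℝ := bgS ∘ₖ bgL p

lemma bgL_apply (p : ℝ) (hp : 0 < p) (c : ℝ) :
    bgL p c = (gammaMeasure p 1).map (fun g => (1 / c - 1) * g) := by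
  have := isProbabilityMeasure_gammaMeasure hp one_pos
  unfold bgL
  rw [Kernel.map_apply _ (by fun_prop), Kernel.prod_apply, Kernel.id_apply, Kernel.const_apply,
    Measure.dirac_prod, Measure.map_map (by fun_prop) (by fun_prop)]
  rfl

lemma bgZ_markov (p : ℝ) (hp : 0 < p) : IsMarkovKernel (bgZ p) := by
  have := isProbabilityMeasure_gammaMeasure hp one_pos
  have : IsMarkovKernel (bgL p) := by
    unfold bgL; exact Kernel.IsMarkovKernel.map _ (by fun_prop)
  unfold bgZ; infer_instance

noncomputable def bgR (σ c : ℝ) : ℂ := (1 - σ * Complex.I) / (1 - c * σ * Complex.I)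

lemma bg_ne (σ : ℝ) : (1 - σ * Complex.I : ℂ) ≠ 0 := by
  intro h
  have := congrArg Complex.re h
  simp at this

lemma bg_ne' (c σ : ℝ) : (1 - c * σ * Complex.I : ℂ) ≠ 0 := by
  have := bg_ne (c * σ)
  push_cast at this; exact this

lemma bg_re_inv (τ : ℝ) : (1 / (1 - τ * Complex.I) : ℂ).re ≤ 1 := by
  have h : (1 / (1 - τ * Complex.I) : ℂ).re = 1 / (1 + τ ^ 2) := by
    simp [Complex.normSq_apply]; ring
  rw [h, div_le_one (by positivity)]
  nlinarith [sq_nonneg τ]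

lemma bgR_eq {σ c : ℝ} (hc : 0 < c) :
    bgR σ c = 1 - ((1 / c - 1 : ℝ) : ℂ) * (1 / (1 - ((c * σ : ℝ) : ℂ) * Complex.I) - 1) := by
  have h1 := bg_ne' c σ
  have : (c : ℂ) ≠ 0 := by exact_mod_cast hc.ne'
  unfold bgR
  push_cast
  generalize hw : (1 - c * σ * Complex.I : ℂ) = w at *
  have hσ : (σ * Complex.I : ℂ) = (1 - w) / c := by rw [← hw]; field_simp; ring
  rw [hσ]
  field_simp
  ring

lemma bgR_re {σ c : ℝ} (hc : 0 ≤ c) (hc1 : c ≤ 1) : 1 ≤ (bgR σ c).re := by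
  unfold bgR
  have : ((1 - σ * Complex.I) / (1 - c * σ * Complex.I) : ℂ).re = (1 + c * σ^2) / (1 + c^2 * σ ^ 2) := by
    rw [Complex.div_re]
    simp [Complex.normSq_apply]
    field_simp
  rw [this, le_div_iff₀ (by positivity)]
  nlinarith [mul_nonneg hc (sq_nonneg σ), mul_nonneg (mul_nonneg hc (sq_nonneg σ)) (sub_nonneg.2 hc1)]

lemma bgZ_cexp (p : ℝ) (hp : 0 < p) {c : ℝ} (hc : 0 < c) (hc1 : c ≤ 1) (σ : ℝ) :
    ∫ x : ℝ, Complex.exp (((c * σ : ℝ) : ℂ) * Complex.I * x) ∂(bgZ p c) = bgR σ c ^ (-(p : ℂ)) := by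
  have := bgZ_markov p hp
  have hb : (0 : ℝ) ≤ 1 / c - 1 := by rw [sub_nonneg, le_div_iff₀ hc]; linarith
  have : IsMarkovKernel (bgS ∘ₖ bgL p) := this
  rw [bgZ, Kernel.integral_comp (bg_intble _ (by fun_prop) 1 (bg_nexp _)), bgL_apply p hp,
    integral_map (by fun_prop)]
  · have : ∀ᵐ g ∂(gammaMeasure p 1),
        (∫ x : ℝ, Complex.exp (((c * σ : ℝ) : ℂ) * Complex.I * x) ∂(bgS ((1 / c - 1) * g))) =
        Complex.exp ((((1 / c - 1 : ℝ) : ℂ) * (1 / (1 - ((c * σ : ℝ) : ℂ) * Complex.I) - 1)) * g) := by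
      filter_upwards [bg_gamma_nonneg p 1] with g hg
      rw [bgS_cexp (mul_nonneg hb hg)]
      push_cast
      ring_nf
    rw [integral_congr_ae this, bg_gamma_cexp hp one_pos, bgR_eq hc]
    · simp
    · rw [Complex.re_ofReal_mul, Complex.sub_re]
      have := bg_re_inv (c * σ)
      have : (1 / c - 1) * ((1 / (1 - ((c * σ : ℝ) : ℂ) * Complex.I)).re - (1 : ℂ).re) ≤ 0 :=
        mul_nonpos_of_nonneg_of_nonpos hb (by simpa using this)
      linarith
  · refine StronglyMeasurable.aestronglyMeasurable ?_
    exact StronglyMeasurable.integral_kernel (κ := bgS) (Measurable.stronglyMeasurable (by fun_prop))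

lemma bg_exists_N (p₁ p₂ α₁ α₂ : ℝ) (hp₁ : 0 < p₁) (hp₂ : 0 < p₂) :
    ∃ N : Measure (ℝ × ℝ), IsProbabilityMeasure N ∧ (∀ᵐ q ∂N, 0 ≤ q.1 ∧ q.1 ≤ 1) ∧
      (∀ k : ℕ, ∫ q, q.1 ^ k ∂N = 1 / (k + 1)) ∧
      ∀ (k : ℝ → ℂ) (C : ℝ), Measurable k → (∀ c, ‖k c‖ ≤ C) → ∀ s : ℝ,
        ∫ q, k q.1 * Complex.exp ((s * q.2 : ℝ) * Complex.I) ∂N =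
        ∫ c in (0:ℝ)..1, k c *
          (bgR (s / α₁) c ^ (-(p₁ : ℂ)) * bgR (-s / α₂) c ^ (-(p₂ : ℂ))) := by
  have := bgZ_markov p₁ hp₁
  have := bgZ_markov p₂ hp₂
  set B : Measure ℝ := volume.restrict (Set.Ioc 0 1) with hB
  have : IsProbabilityMeasure B := ⟨by simp [hB]⟩
  set M := B ⊗ₘ (bgZ p₁ ×ₖ bgZ p₂) with hM
  set T : ℝ × ℝ × ℝ → ℝ × ℝ := fun q => (q.1, q.1 * (q.2.1 / α₁ - q.2.2 / α₂)) with hT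
  have hTm : Measurable T := by fun_prop
  have hfst : M.map Prod.fst = B := by
    change M.fst = B
    rw [hM, Measure.fst_compProd]
  have hfst' : (M.map T).map Prod.fst = B := by
    rw [Measure.map_map (by fun_prop) hTm, ← hfst]; rfl
  refine ⟨M.map T, Measure.isProbabilityMeasure_map hTm.aemeasurable, ?_, ?_, ?_⟩
  · have : ∀ᵐ c ∂B, 0 ≤ c ∧ c ≤ 1 := by
      filter_upwards [ae_restrict_mem measurableSet_Ioc] with c hc using ⟨hc.1.le, hc.2⟩
    rw [← hfst'] at this
    exact ae_of_ae_map (by fun_prop) this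
  · intro k
    have : ∫ c, c ^ k ∂B = 1 / (k + 1) := by
      rw [hB, ← intervalIntegral.integral_of_le zero_le_one, integral_pow]; simp
    rw [← this, ← hfst', integral_map (μ := M.map T) (φ := Prod.fst) (by fun_prop) (by fun_prop)]
  · intro k C hk hkC s
    rw [integral_map hTm.aemeasurable (by fun_prop), hM, Measure.integral_compProd]
    · rw [intervalIntegral.integral_of_le zero_le_one]
      refine setIntegral_congr_fun measurableSet_Ioc fun c hc => ?_
      simp only [hT]
      rw [Kernel.prod_apply, ← bgZ_cexp p₁ hp₁ hc.1 hc.2, ← bgZ_cexp p₂ hp₂ hc.1 hc.2,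
        ← integral_prod_mul, ← integral_const_mul]
      congr 1; ext e
      rw [← Complex.exp_add]
      congr 2; push_cast; ring
    · refine bg_intble _ (by fun_prop) C fun x => ?_
      rw [norm_mul, bg_norm_cexp, mul_one]
      exact hkC _

def BGGood (Φ : (ℝ → ℂ) → ℂ) : Prop :=
  ∃ ρ σ : Measure ℝ, IsFiniteMeasure ρ ∧ IsFiniteMeasure σ ∧
    ∀ ψ : ℝ → ℂ, Measurable ψ → (∃ C, ∀ x, ‖ψ x‖ ≤ C) → Φ ψ = ∫ x, ψ x ∂ρ - ∫ x, ψ x ∂σ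

lemma BGGood.add {Φ Ψ : (ℝ → ℂ) → ℂ} (h : BGGood Φ) (h' : BGGood Ψ) :
    BGGood (fun ψ => Φ ψ + Ψ ψ) := by
  obtain ⟨ρ, σ, hρ, hσ, h⟩ := h
  obtain ⟨ρ', σ', hρ', hσ', h'⟩ := h'
  refine ⟨ρ + ρ', σ + σ', inferInstance, inferInstance, fun ψ hm hb => ?_⟩
  obtain ⟨C, hC⟩ := hb
  have hi : ∀ (μ : Measure ℝ) [IsFiniteMeasure μ], Integrable ψ μ := fun μ _ => bg_intble μ hm C hC
  change Φ ψ + Ψ ψ = _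
  rw [h ψ hm ⟨C, hC⟩, h' ψ hm ⟨C, hC⟩, integral_add_measure (hi _) (hi _),
    integral_add_measure (hi _) (hi _)]
  ring

lemma BGGood.push {α : Type*} [MeasurableSpace α] {μ : Measure α} {w T : α → ℝ}
    (hw : Measurable w) (hwi : Integrable w μ) (hT : Measurable T) :
    BGGood (fun ψ => ∫ a, (w a : ℂ) * ψ (T a) ∂μ) := by
  have hf : ∀ v : α → ℝ, Integrable v μ →
      IsFiniteMeasure ((μ.withDensity (fun a => ENNReal.ofReal (v a))).map T) := by
    intro v hv
    have : IsFiniteMeasure (μ.withDensity (fun a => ENNReal.ofReal (v a))) :=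
      isFiniteMeasure_withDensity_ofReal hv.2
    infer_instance
  refine ⟨_, _, hf w hwi, hf (fun a => - w a) hwi.neg, fun ψ hm hb => ?_⟩
  obtain ⟨C, hC⟩ := hb
  have hb : MemLp (fun a => ψ (T a)) ⊤ μ :=
    memLp_top_of_bound (hm.comp hT).aestronglyMeasurable C (ae_of_all _ fun a => hC _)
  rw [integral_map hT.aemeasurable hm.aestronglyMeasurable,
    integral_map hT.aemeasurable hm.aestronglyMeasurable,
    integral_withDensity_eq_integral_toReal_smul (by fun_prop) (by simp),
    integral_withDensity_eq_integral_toReal_smul (by fun_prop) (by simp), ← integral_sub]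
  · refine integral_congr_ae (ae_of_all _ fun a => ?_)
    simp only []
    rw [ENNReal.toReal_ofReal', ENNReal.toReal_ofReal', ← sub_smul, Complex.real_smul]
    congr 2
    rcases le_total 0 (w a) with h | h
    · simp [h]
    · simp [h]
  · simp_rw [ENNReal.toReal_ofReal', Complex.real_smul]
    exact hwi.pos_part.ofReal.mul_of_top_left hb
  · simp_rw [ENNReal.toReal_ofReal', Complex.real_smul]
    exact hwi.neg_part.ofReal.mul_of_top_left hb

lemma BGGood.zero {Φ : (ℝ → ℂ) → ℂ} (h : BGGood Φ)
    (h0 : ∀ s : ℝ, Φ (fun x => Complex.exp ((s * x : ℝ) * Complex.I)) = 0)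
    (ψ : ℝ → ℂ) (hm : Measurable ψ) (hb : ∃ C, ∀ x, ‖ψ x‖ ≤ C) : Φ ψ = 0 := by
  obtain ⟨ρ, σ, hρ, hσ, h⟩ := h
  have : ρ = σ := by
    apply Measure.ext_of_charFun
    ext s
    have h1 := h _ (by fun_prop) ⟨1, fun x => (bg_norm_cexp (s * x)).le⟩
    rw [h0 s] at h1
    rw [charFun_apply_real, charFun_apply_real, ← sub_eq_zero]
    rw [h1]; push_cast; rfl
  rw [h ψ hm hb, this, sub_self]

lemma bg_line {μ : Measure ℝ} [IsProbabilityMeasure μ] (hμ : Integrable (fun x : ℝ => x) μ)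
    {h ψ : ℝ → ℂ} (hd : ∀ x, HasDerivAt h (ψ x) x) (hc : Continuous ψ) (C : ℝ)
    (hC : ∀ x, ‖ψ x‖ ≤ C) (hi : Integrable h μ) (x : ℝ) :
    ∫ a : ℝ × ℝ, ((-(x - a.1) : ℝ) : ℂ) * ψ (a.1 + a.2 * (x - a.1))
      ∂(μ.prod (volume.restrict (Set.Ioc 0 1))) = -(h x - ∫ ξ, h ξ ∂μ) := by
  rw [integral_prod]
  · have : ∀ ξ : ℝ, ∫ θ in Set.Ioc (0:ℝ) 1, ((-(x - ξ) : ℝ) : ℂ) * ψ (ξ + θ * (x - ξ)) =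
        -(h x - h ξ) := by
      intro ξ
      rw [← intervalIntegral.integral_of_le zero_le_one]
      rw [intervalIntegral.integral_eq_sub_of_hasDerivAt (f := fun θ : ℝ => - h (ξ + θ * (x - ξ)))]
      · simp; ring
      · intro θ _
        have h1 : HasDerivAt (fun θ : ℝ => ξ + θ * (x - ξ)) (x - ξ) θ := by
          simpa using ((hasDerivAt_id θ).mul_const (x - ξ)).const_add ξ
        have := ((hd (ξ + θ * (x - ξ))).scomp θ h1).neg
        convert! this using 1
        rw [Complex.real_smul]; push_cast; ring
      · apply Continuous.intervalIntegrable; fun_prop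
    simp_rw [this]
    rw [integral_neg, integral_sub (integrable_const _) hi]
    simp
  · have h1 : Integrable (fun a : ℝ × ℝ => ((-(x - a.1) : ℝ) : ℂ))
        (μ.prod (volume.restrict (Set.Ioc (0:ℝ) 1))) := by
      have h2 : Integrable (fun ξ : ℝ => ((-(x - ξ) : ℝ) : ℂ)) μ :=
        (((integrable_const x).sub hμ).neg).ofReal
      exact h2.comp_fst _
    refine h1.mul_of_top_left ?_
    exact memLp_top_of_bound (by fun_prop) C (ae_of_all _ fun a => hC _)

lemma bgR_deriv (p σ : ℝ) {c : ℝ} (hc : 0 ≤ c) (hc1 : c ≤ 1) :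
    HasDerivAt (fun c : ℝ => bgR σ c ^ (-(p : ℂ)))
      (-(p : ℂ) * (σ * Complex.I / (1 - c * σ * Complex.I)) * bgR σ c ^ (-(p : ℂ))) c := by
  have h0 := bg_ne' c σ
  have h1 : HasDerivAt (fun c : ℝ => (1 - c * σ * Complex.I : ℂ)) (-(σ * Complex.I)) c := by
    have := (((Complex.ofRealCLM.hasDerivAt (x := c)).mul_const (σ * Complex.I : ℂ))).const_sub 1
    simpa [mul_assoc] using this
  have h2 : HasDerivAt (fun c : ℝ => bgR σ c) (bgR σ c * (σ * Complex.I / (1 - c * σ * Complex.I))) c := by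
    have := (hasDerivAt_const c (1 - σ * Complex.I : ℂ)).div h1 h0
    convert! this using 1
    unfold bgR
    field_simp
    ring
  have hre := bgR_re (σ := σ) hc hc1
  have hne : bgR σ c ≠ 0 := by
    intro h; rw [h] at hre; simp at hre; linarith
  have hsl : bgR σ c ∈ Complex.slitPlane := Or.inl (by linarith)
  have h3 := (Complex.hasStrictDerivAt_cpow_const (c := -(p : ℂ)) hsl).hasDerivAt.comp c h2
  convert! h3 using 1
  rw [Complex.cpow_sub _ _ hne, Complex.cpow_one]
  field_simp

lemma bg_ftc (p₁ p₂ σ₁ σ₂ t : ℝ) :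
    ∫ c in (0:ℝ)..1, ((t * Complex.I - p₁ * (σ₁ * Complex.I / (1 - c * σ₁ * Complex.I))
        - p₂ * (σ₂ * Complex.I / (1 - c * σ₂ * Complex.I))) * Complex.exp ((t * c : ℝ) * Complex.I))
        * (bgR σ₁ c ^ (-(p₁ : ℂ)) * bgR σ₂ c ^ (-(p₂ : ℂ))) =
      Complex.exp (t * Complex.I) -
        (1 - σ₁ * Complex.I) ^ (-(p₁ : ℂ)) * (1 - σ₂ * Complex.I) ^ (-(p₂ : ℂ)) := by
  rw [intervalIntegral.integral_eq_sub_of_hasDerivAt (f := fun c : ℝ =>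
    Complex.exp ((t * c : ℝ) * Complex.I) * (bgR σ₁ c ^ (-(p₁ : ℂ)) * bgR σ₂ c ^ (-(p₂ : ℂ))))]
  · simp [bgR, div_self (bg_ne σ₁), div_self (bg_ne σ₂)]
  · intro c hc
    rw [Set.uIcc_of_le zero_le_one] at hc
    have h1 : HasDerivAt (fun c : ℝ => Complex.exp ((t * c : ℝ) * Complex.I))
        (Complex.exp ((t * c : ℝ) * Complex.I) * (t * Complex.I)) c := by
      apply HasDerivAt.cexp
      have := (Complex.ofRealCLM.hasDerivAt (x := c)).mul_const (t * Complex.I : ℂ)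
      convert! this using 1
      · ext y; simp; ring
      · simp
    have := h1.mul ((bgR_deriv p₁ σ₁ hc.1 hc.2).mul (bgR_deriv p₂ σ₂ hc.1 hc.2))
    convert! this using 1
    simp only [Pi.mul_apply]
    ring
  · apply ContinuousOn.intervalIntegrable
    rw [Set.uIcc_of_le zero_le_one]
    have hR : ∀ p σ : ℝ, ContinuousOn (fun c : ℝ => bgR σ c ^ (-(p : ℂ))) (Set.Icc 0 1) :=
      fun p σ c hc => (bgR_deriv p σ hc.1 hc.2).continuousAt.continuousWithinAt
    have hq : ∀ σ : ℝ, Continuous (fun c : ℝ => (σ * Complex.I / (1 - c * σ * Complex.I) : ℂ)) :=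
      fun σ => by
        apply Continuous.div (by fun_prop) (by fun_prop) (fun c => bg_ne' c σ)
    have h1 := hR p₁ σ₁
    have h2 := hR p₂ σ₂
    have h3 := hq σ₁
    have h4 := hq σ₂
    apply ContinuousOn.mul _ (h1.mul h2)
    apply Continuous.continuousOn
    fun_prop

lemma bg_exp1_cexp {α : ℝ} (hα : 0 < α) (s : ℝ) :
    ∫ u : ℝ, Complex.exp (s * Complex.I * u) ∂(gammaMeasure 1 α) =
      1 / (1 - ((s / α : ℝ) : ℂ) * Complex.I) := by
  rw [bg_gamma_cexp one_pos hα (by simpa using hα)]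
  rw [Complex.ofReal_one, Complex.cpow_neg_one, one_div]
  congr 2; push_cast; ring

lemma bg_inv_norm (τ : ℝ) : ‖(1 / (1 - τ * Complex.I) : ℂ)‖ ≤ 1 := by
  rw [norm_div, norm_one]
  have h : 1 ≤ ‖(1 - τ * Complex.I : ℂ)‖ := by
    calc (1:ℝ) = |(1 - τ * Complex.I : ℂ).re| := by simp
      _ ≤ _ := Complex.abs_re_le_norm _
  exact (div_le_one (by linarith)).2 h

lemma bg_stein {p₁ p₂ α₁ α₂ : ℝ} (hα₁ : 0 < α₁) (hα₂ : 0 < α₂)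
    {N : Measure (ℝ × ℝ)} [IsProbabilityMeasure N]
    (hN : ∀ (k : ℝ → ℂ) (C : ℝ), Measurable k → (∀ c, ‖k c‖ ≤ C) → ∀ s : ℝ,
        ∫ q, k q.1 * Complex.exp ((s * q.2 : ℝ) * Complex.I) ∂N =
        ∫ c in (0:ℝ)..1, k c *
          (bgR (s / α₁) c ^ (-(p₁ : ℂ)) * bgR (-s / α₂) c ^ (-(p₂ : ℂ))))
    {μ : Measure ℝ} [IsProbabilityMeasure μ] (hμ : Integrable (fun x : ℝ => x) μ)
    (hμm : ∫ x, x ∂μ = p₁ / α₁ - p₂ / α₂)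
    (hμc : ∀ s : ℝ, ∫ x : ℝ, Complex.exp ((s * x : ℝ) * Complex.I) ∂μ =
      (1 - ((s / α₁ : ℝ) : ℂ) * Complex.I) ^ (-(p₁ : ℂ)) *
      (1 - ((-s / α₂ : ℝ) : ℂ) * Complex.I) ^ (-(p₂ : ℂ)))
    (x : ℝ) {h ψ : ℝ → ℂ} (hd : ∀ x, HasDerivAt h (ψ x) x) (hc : Continuous ψ) (C : ℝ)
    (hC : ∀ x, ‖ψ x‖ ≤ C) (hi : Integrable h μ) :
    ∫ q, (x : ℂ) * ψ (q.1 * x + q.2) ∂N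
      + ∫ q : (ℝ × ℝ) × ℝ, ((-(p₁ / α₁) : ℝ) : ℂ) * ψ (q.1.1 * (x + q.2) + q.1.2)
          ∂(N.prod (gammaMeasure 1 α₁))
      + ∫ q : (ℝ × ℝ) × ℝ, ((p₂ / α₂ : ℝ) : ℂ) * ψ (q.1.1 * (x - q.2) + q.1.2)
          ∂(N.prod (gammaMeasure 1 α₂))
      = h x - ∫ ξ, h ξ ∂μ := by
  have i1 := isProbabilityMeasure_gammaMeasure one_pos hα₁
  have i2 := isProbabilityMeasure_gammaMeasure one_pos hα₂
  have hB : IsProbabilityMeasure (volume.restrict (Set.Ioc (0:ℝ) 1)) := ⟨by simp⟩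
  set Φ : (ℝ → ℂ) → ℂ := fun ψ => ∫ q, (x : ℂ) * ψ (q.1 * x + q.2) ∂N
      + ∫ q : (ℝ × ℝ) × ℝ, ((-(p₁ / α₁) : ℝ) : ℂ) * ψ (q.1.1 * (x + q.2) + q.1.2)
          ∂(N.prod (gammaMeasure 1 α₁))
      + ∫ q : (ℝ × ℝ) × ℝ, ((p₂ / α₂ : ℝ) : ℂ) * ψ (q.1.1 * (x - q.2) + q.1.2)
          ∂(N.prod (gammaMeasure 1 α₂))
      + ∫ a : ℝ × ℝ, ((-(x - a.1) : ℝ) : ℂ) * ψ (a.1 + a.2 * (x - a.1))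
      ∂(μ.prod (volume.restrict (Set.Ioc 0 1))) with hΦ
  have hgood : BGGood Φ := by
    refine (((BGGood.push (w := fun _ => x) (T := fun q : ℝ × ℝ => q.1 * x + q.2) (by fun_prop) (integrable_const _) (by fun_prop)).add
      (BGGood.push (w := fun _ => -(p₁ / α₁)) (T := fun q : (ℝ × ℝ) × ℝ => q.1.1 * (x + q.2) + q.1.2) (by fun_prop) (integrable_const _) (by fun_prop))).add
      (BGGood.push (w := fun _ => p₂ / α₂) (T := fun q : (ℝ × ℝ) × ℝ => q.1.1 * (x - q.2) + q.1.2) (by fun_prop) (integrable_const _) (by fun_prop))).add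
      (BGGood.push (w := fun a : ℝ × ℝ => -(x - a.1)) (T := fun a : ℝ × ℝ => a.1 + a.2 * (x - a.1)) (by fun_prop) ?_ (by fun_prop))
    have h2 : Integrable (fun ξ : ℝ => -(x - ξ)) μ := (((integrable_const x).sub hμ).neg)
    exact h2.comp_fst _
  have key : Φ ψ = 0 := by
    refine hgood.zero ?_ ψ hc.measurable ⟨C, hC⟩
    intro s
    rcases eq_or_ne s 0 with rfl | hs
    · simp only [hΦ, zero_mul, Complex.ofReal_zero, Complex.exp_zero, mul_one]
      have e : ∫ a : ℝ × ℝ, ((-(x - a.1) : ℝ) : ℂ) ∂(μ.prod (volume.restrict (Set.Ioc 0 1))) =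
          -(x - (p₁ / α₁ - p₂ / α₂)) := by
        rw [integral_fun_fst (fun ξ : ℝ => ((-(x - ξ) : ℝ) : ℂ)), integral_complex_ofReal, integral_neg,
          integral_sub (integrable_const _) hμ, hμm]
        simp
      rw [e]
      simp
      ring
    · set E : ℝ → ℂ := fun x => Complex.exp ((s * x : ℝ) * Complex.I) with hE
      have hsI : (s * Complex.I : ℂ) ≠ 0 := by simp [hs]
      have hEd : ∀ x, HasDerivAt (fun x => E x / (s * Complex.I)) (E x) x := by
        intro x
        have h1 : HasDerivAt E (Complex.exp ((s * x : ℝ) * Complex.I) * (s * Complex.I)) x := by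
          apply HasDerivAt.cexp
          have := (Complex.ofRealCLM.hasDerivAt (x := x)).mul_const (s * Complex.I : ℂ)
          convert! this using 1
          · ext y; simp; ring
          · simp
        have := h1.div_const (s * Complex.I)
        rwa [mul_div_cancel_right₀ _ hsI] at this
      have hEb : ∀ x, ‖E x‖ ≤ 1 := fun x => (bg_norm_cexp (s * x)).le
      have hEc : Continuous E := by fun_prop
      have t4 := bg_line hμ hEd hEc 1 hEb ((bg_intble _ hEc.measurable 1 hEb).div_const _) x
      rw [integral_div, hμc] at t4
      have fub : ∀ (α a ε : ℝ), 0 < α → 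
          ∫ q : (ℝ × ℝ) × ℝ, (a : ℂ) * E (q.1.1 * (x + ε * q.2) + q.1.2)
            ∂(N.prod (gammaMeasure 1 α)) =
          ∫ q : ℝ × ℝ, (a * (1 / (1 - ((q.1 * (ε * s / α) : ℝ) : ℂ) * Complex.I)) *
            Complex.exp ((s * x * q.1 : ℝ) * Complex.I)) *
              Complex.exp ((s * q.2 : ℝ) * Complex.I) ∂N := by
        intro α a ε hα
        have i3 := isProbabilityMeasure_gammaMeasure one_pos hα
        rw [integral_prod]
        · congr 1; ext q
          have := bg_exp1_cexp hα (q.1 * ε * s)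
          rw [show q.1 * (ε * s / α) = q.1 * ε * s / α by ring, ← this, mul_assoc, mul_assoc, integral_const_mul,
            ← integral_mul_const]
          congr 2; ext u
          rw [hE]
          try simp only []
          rw [← Complex.exp_add, ← Complex.exp_add]
          congr 1; push_cast; ring
        · exact (bg_intble _ (by fun_prop) 1 fun x => hEb _).const_mul _
      have f1 := fub α₁ (-(p₁ / α₁)) 1 hα₁
      have f2 := fub α₂ (p₂ / α₂) (-1) hα₂
      simp only [one_mul, neg_mul, ← sub_eq_add_neg] at f1 f2
      have hkb : ∀ (a σ c : ℝ), ‖a * (1 / (1 - ((c * σ : ℝ) : ℂ) * Complex.I)) *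
            Complex.exp ((s * x * c : ℝ) * Complex.I)‖ ≤ |a| := by
        intro a σ c
        rw [norm_mul, norm_mul, bg_norm_cexp, mul_one]
        have := bg_inv_norm (c * σ)
        simp only [Complex.norm_real, Real.norm_eq_abs]
        exact mul_le_of_le_one_right (abs_nonneg _) this
      have hkm : ∀ (a σ : ℝ), Measurable fun c : ℝ => (a * (1 / (1 - ((c * σ : ℝ) : ℂ) * Complex.I)) *
            Complex.exp ((s * x * c : ℝ) * Complex.I)) := by
        intro a σ; fun_prop
      have hki : ∀ (a σ : ℝ), Integrable (fun q : ℝ × ℝ => (a * (1 / (1 - ((q.1 * σ : ℝ) : ℂ) * Complex.I)) *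
            Complex.exp ((s * x * q.1 : ℝ) * Complex.I)) * Complex.exp ((s * q.2 : ℝ) * Complex.I)) N := by
        intro a σ
        refine bg_intble _ (by fun_prop) |a| fun q => ?_
        rw [norm_mul, bg_norm_cexp, mul_one]
        exact hkb a σ q.1
      have hk2 : ∀ (a σ b τ : ℝ), Integrable (fun q : ℝ × ℝ => (a * (1 / (1 - ((q.1 * σ : ℝ) : ℂ) * Complex.I)) *
            Complex.exp ((s * x * q.1 : ℝ) * Complex.I)) * Complex.exp ((s * q.2 : ℝ) * Complex.I)
            + (b * (1 / (1 - ((q.1 * τ : ℝ) : ℂ) * Complex.I)) *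
            Complex.exp ((s * x * q.1 : ℝ) * Complex.I)) * Complex.exp ((s * q.2 : ℝ) * Complex.I)) N :=
        fun a σ b τ => (hki a σ).add (hki b τ)
      have f0 : ∫ q, (x : ℂ) * E (q.1 * x + q.2) ∂N = ∫ q : ℝ × ℝ, (x * (1 / (1 - ((q.1 * 0 : ℝ) : ℂ) * Complex.I)) *
            Complex.exp ((s * x * q.1 : ℝ) * Complex.I)) * Complex.exp ((s * q.2 : ℝ) * Complex.I) ∂N := by
        congr 1; ext q
        rw [hE]; simp only []
        rw [mul_assoc, ← Complex.exp_add]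
        simp only [mul_zero, Complex.ofReal_zero, zero_mul, sub_zero, div_one, mul_one]
        congr 2; push_cast; ring
      change (∫ q, (x : ℂ) * E (q.1 * x + q.2) ∂N) + _ + _ + _ = 0
      rw [t4, f0, f1, f2, ← integral_add (hki _ _) (hki _ _), ← integral_add (hk2 _ _ _ _) (hki _ _)]
      simp_rw [← add_mul]
      have hN' := hN (fun c => x * (1 / (1 - ((c * 0 : ℝ) : ℂ) * Complex.I)) * Complex.exp ((s * x * c : ℝ) * Complex.I)
        + (-(p₁ / α₁) : ℝ) * (1 / (1 - ((c * (s / α₁) : ℝ) : ℂ) * Complex.I)) * Complex.exp ((s * x * c : ℝ) * Complex.I)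
        + (p₂ / α₂ : ℝ) * (1 / (1 - ((c * (-s / α₂) : ℝ) : ℂ) * Complex.I)) * Complex.exp ((s * x * c : ℝ) * Complex.I))
        (|x| + |-(p₁ / α₁)| + |p₂ / α₂|) (by fun_prop)
        (fun c => (norm_add_le _ _).trans (add_le_add ((norm_add_le _ _).trans (add_le_add (hkb _ _ _) (hkb _ _ _))) (hkb _ _ _))) s
      simp only [← add_mul] at hN'
      have hft := bg_ftc p₁ p₂ (s / α₁) (-s / α₂) (s * x)
      rw [hN', ← sub_div, hE]
      try simp only []
      rw [← hft, ← sub_eq_add_neg, sub_eq_zero, eq_div_iff hsI, ← intervalIntegral.integral_mul_const]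
      refine intervalIntegral.integral_congr fun c _ => ?_
      try simp only []
      have : (x * (1 / (1 - ((c * 0 : ℝ) : ℂ) * Complex.I)) 
        + (-(p₁ / α₁) : ℝ) * (1 / (1 - ((c * (s / α₁) : ℝ) : ℂ) * Complex.I))
        + (p₂ / α₂ : ℝ) * (1 / (1 - ((c * (-s / α₂) : ℝ) : ℂ) * Complex.I))) * (s * Complex.I) =
        (((s * x : ℝ) : ℂ) * Complex.I - p₁ * (((s / α₁ : ℝ) : ℂ) * Complex.I / (1 - c * ((s / α₁ : ℝ) : ℂ) * Complex.I))
        - p₂ * (((-s / α₂ : ℝ) : ℂ) * Complex.I / (1 - c * ((-s / α₂ : ℝ) : ℂ) * Complex.I))) := by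
        push_cast
        simp only [mul_zero, zero_mul, sub_zero, div_one]
        ring
      rw [← this]
      ring
  have l := bg_line hμ hd hc C hC hi x
  simp only [hΦ, l] at key
  linear_combination key

lemma bg_intR {T : Type*} [MeasurableSpace T] (ν : Measure T) [IsProbabilityMeasure ν]
    {f : T → ℝ} (hf : Measurable f) (C : ℝ) (h : ∀ᵐ t ∂ν, |f t| ≤ C) : Integrable f ν :=
  Integrable.of_bound hf.aestronglyMeasurable C (by simpa [Real.norm_eq_abs] using h)

lemma bg_avg {T : Type*} [MeasurableSpace T] (ν : Measure T) [IsProbabilityMeasure ν]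
    {w a b : T → ℝ} (hw : Measurable w) (ha : Measurable a) (hb : Measurable b)
    (hw1 : ∀ᵐ t ∂ν, |w t| ≤ 1) (ha1 : ∀ᵐ t ∂ν, |a t| ≤ 1)
    {g g' : ℝ → ℝ} (hg : ∀ y, HasDerivAt g (g' y) y) {C C' : ℝ}
    (hC : ∀ y, |g y| ≤ C) (hC' : ∀ y, |g' y| ≤ C') (y : ℝ) :
    HasDerivAt (fun y => ∫ t, w t * g (a t * y + b t) ∂ν)
      (∫ t, (w t * a t) * g' (a t * y + b t) ∂ν) y := by
  have hgm : Measurable g :=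
    (continuous_iff_continuousAt.2 fun y => (hg y).continuousAt).measurable
  have hg'm : Measurable g' := by
    have : g' = deriv g := funext fun y => (hg y).deriv.symm
    rw [this]; exact measurable_deriv g
  have h0 : 0 ≤ C' := (abs_nonneg _).trans (hC' 0)
  have h00 : 0 ≤ C := (abs_nonneg _).trans (hC 0)
  refine (hasDerivAt_integral_of_dominated_loc_of_deriv_le (s := Set.univ) (bound := fun _ => C')
    (F := fun y t => w t * g (a t * y + b t))
    (F' := fun y t => (w t * a t) * g' (a t * y + b t)) Filter.univ_mem ?_ ?_ ?_ ?_ ?_ ?_).2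
  · exact Filter.Eventually.of_forall fun y => by
      apply Measurable.aestronglyMeasurable; fun_prop
  · refine bg_intR ν (by fun_prop) C ?_
    filter_upwards [hw1] with t h1
    rw [abs_mul]
    nlinarith [hC (a t * y + b t), abs_nonneg (g (a t * y + b t)), abs_nonneg (w t)]
  · apply Measurable.aestronglyMeasurable; fun_prop
  · filter_upwards [hw1, ha1] with t h1 h2 y _
    rw [Real.norm_eq_abs, abs_mul, abs_mul]
    have : |w t| * |a t| ≤ 1 := by nlinarith [abs_nonneg (w t), abs_nonneg (a t)]
    calc _ ≤ 1 * C' := by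
          apply mul_le_mul this (hC' _) (abs_nonneg _) zero_le_one
      _ = C' := one_mul _
  · exact integrable_const _
  · refine Filter.Eventually.of_forall fun t y _ => ?_
    have h1 : HasDerivAt (fun y => a t * y + b t) (a t) y := by
      simpa using ((hasDerivAt_id y).const_mul (a t)).add_const (b t)
    have := ((hg (a t * y + b t)).comp y h1).const_mul (w t)
    refine this.congr_deriv ?_
    ring

/-- averaging against a signed exponential variable -/
noncomputable def bgA (α σ : ℝ) (g : ℝ → ℝ) (y : ℝ) : ℝ :=
  ∫ u, g (y + σ * u) ∂(gammaMeasure 1 α)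

lemma bgA_deriv {α : ℝ} (hα : 0 < α) (σ : ℝ) {g g' : ℝ → ℝ} (hg : ∀ y, HasDerivAt g (g' y) y)
    {C C' : ℝ} (hC : ∀ y, |g y| ≤ C) (hC' : ∀ y, |g' y| ≤ C') (y : ℝ) :
    HasDerivAt (bgA α σ g) (bgA α σ g' y) y := by
  have i1 := isProbabilityMeasure_gammaMeasure one_pos hα
  have := bg_avg (gammaMeasure 1 α) (w := fun _ => 1) (a := fun _ => 1) (b := fun u => σ * u)
    measurable_const measurable_const (by fun_prop) (by simp) (by simp) hg hC hC' y
  simp only [one_mul, mul_one] at this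
  exact this

lemma bgA_bound {α : ℝ} (hα : 0 < α) (σ : ℝ) {g : ℝ → ℝ}
    {C : ℝ} (hC : ∀ y, |g y| ≤ C) (y : ℝ) : |bgA α σ g y| ≤ C := by
  have i1 := isProbabilityMeasure_gammaMeasure one_pos hα
  have := norm_integral_le_of_norm_le_const (μ := gammaMeasure 1 α) (C := C)
    (f := fun u => g (y + σ * u)) (Filter.Eventually.of_forall fun u => hC _)
  simpa [bgA] using this

lemma bgA_lin {α : ℝ} (hα : 0 < α) (σ : ℝ) {g k : ℝ → ℝ} (hg : Measurable g) (hk : Measurable k)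
    {C C' : ℝ} (hC : ∀ y, |g y| ≤ C) (hC' : ∀ y, |k y| ≤ C') (c y : ℝ) :
    bgA α σ (fun z => g z + c * k z) y = bgA α σ g y + c * bgA α σ k y := by
  have i1 := isProbabilityMeasure_gammaMeasure one_pos hα
  unfold bgA
  rw [integral_add, integral_const_mul]
  · exact bg_intR _ (by fun_prop) C (Filter.Eventually.of_forall fun u => hC _)
  · exact (bg_intR _ (by fun_prop) C' (Filter.Eventually.of_forall fun u => hC' _)).const_mul _

lemma bgA_eq {α : ℝ} (hα : 0 < α) (σ : ℝ) {g : ℝ → ℝ} (y : ℝ) :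
    bgA α σ g y = ∫ u in Set.Ioi (0:ℝ), (α * Real.exp (-(α * u))) * g (y + σ * u) := by
  unfold bgA
  rw [bg_gamma_integral one_pos hα, ← integral_Ici_eq_integral_Ioi,
    ← integral_indicator measurableSet_Ici]
  congr 1
  ext u
  by_cases hu : 0 ≤ u
  · simp [gammaPDFReal, hu]
  · simp [gammaPDFReal, hu]

lemma bgA_inv {α : ℝ} (hα : 0 < α) (σ : ℝ) {g g' : ℝ → ℝ} (hg : ∀ y, HasDerivAt g (g' y) y)
    {C C' : ℝ} (hC : ∀ y, |g y| ≤ C) (hC' : ∀ y, |g' y| ≤ C') (y : ℝ) :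
    bgA α σ g y + -(σ / α) * bgA α σ g' y = g y := by
  have hgm : Measurable g :=
    (continuous_iff_continuousAt.2 fun y => (hg y).continuousAt).measurable
  have hg'm : Measurable g' := by
    have : g' = deriv g := funext fun y => (hg y).deriv.symm
    rw [this]; exact measurable_deriv g
  have he : IntegrableOn (fun u => α * Real.exp (-(α * u))) (Set.Ioi (0:ℝ)) := by
    have := (integrableOn_exp_mul_Ioi (a := -α) (by linarith) 0).integrable.const_mul α
    simpa [IntegrableOn] using this
  have hb : ∀ (k : ℝ → ℝ) (C : ℝ), Measurable k → (∀ y, |k y| ≤ C) →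
      IntegrableOn (fun u => (α * Real.exp (-(α * u))) * k (y + σ * u)) (Set.Ioi (0:ℝ)) := by
    intro k C hk hC
    refine Integrable.mul_bdd (c := C) he ?_ ?_
    · apply Measurable.aestronglyMeasurable; fun_prop
    · exact Filter.Eventually.of_forall fun u => hC _
  rw [bgA_eq hα, bgA_eq hα, ← integral_const_mul, ← integral_add (hb g C hgm hC)
    ((hb g' C' hg'm hC').const_mul _)]
  have hd : ∀ u : ℝ, HasDerivAt (fun u => -(Real.exp (-(α * u)) * g (y + σ * u)))
      ((α * Real.exp (-(α * u))) * g (y + σ * u)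
        + -(σ / α) * ((α * Real.exp (-(α * u))) * g' (y + σ * u))) u := by
    intro u
    have h1 : HasDerivAt (fun u => y + σ * u) σ u := by
      simpa using ((hasDerivAt_id u).const_mul σ).const_add y
    have h2 : HasDerivAt (fun u => -(α * u)) (-α) u := by
      simpa using (hasDerivAt_id u).const_mul (-α)
    have := (h2.exp.mul ((hg (y + σ * u)).comp u h1)).neg
    refine this.congr_deriv ?_
    simp only [Function.comp]
    field_simp
    ring
  have ht : Filter.Tendsto (fun u => -(Real.exp (-(α * u)) * g (y + σ * u))) Filter.atTop
      (nhds 0) := by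
    have e0 : Filter.Tendsto (fun u => Real.exp (-(α * u)) * C) Filter.atTop (nhds 0) := by
      have : Filter.Tendsto (fun u : ℝ => Real.exp (-(α * u))) Filter.atTop (nhds 0) :=
        Real.tendsto_exp_neg_atTop_nhds_zero.comp (Filter.tendsto_id.const_mul_atTop hα)
      simpa using this.mul_const C
    refine squeeze_zero_norm (fun u => ?_) e0
    rw [norm_neg, norm_mul, Real.norm_eq_abs, abs_of_pos (Real.exp_pos _)]
    exact mul_le_mul_of_nonneg_left (hC _) (Real.exp_pos _).le
  rw [integral_Ioi_of_hasDerivAt_of_tendsto' (fun u _ => hd u)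
    ((hb g C hgm hC).add ((hb g' C' hg'm hC').const_mul _)) ht]
  simp

lemma bg_W {α₁ α₂ : ℝ} (hα₁ : 0 < α₁) (hα₂ : 0 < α₂) {f f' f'' : ℝ → ℝ}
    (hf : ∀ y, HasDerivAt f (f' y) y) (hf' : ∀ y, HasDerivAt f' (f'' y) y) {C C' C'' : ℝ}
    (hC : ∀ y, |f y| ≤ C) (hC' : ∀ y, |f' y| ≤ C') (hC'' : ∀ y, |f'' y| ≤ C'') :
    ∃ W W' W'' : ℝ → ℝ, (∀ y, HasDerivAt W (W' y) y) ∧ (∀ y, HasDerivAt W' (W'' y) y) ∧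
      (∀ y, |W y| ≤ C) ∧ (∀ y, |W' y| ≤ C') ∧ (∀ y, |W'' y| ≤ C'') ∧
      (∀ y, bgA α₁ 1 f y = W y + 1 / α₂ * W' y) ∧
      (∀ y, bgA α₂ (-1) f y = W y - 1 / α₁ * W' y) ∧
      (∀ y, f y = W y - (1 / α₁ - 1 / α₂) * W' y - 1 / (α₁ * α₂) * W'' y) := by
  have d1 := bgA_deriv hα₂ (-1) hf hC hC'
  have d2 := bgA_deriv hα₂ (-1) hf' hC' hC''
  have b0 := bgA_bound hα₂ (-1) hC
  have b1 := bgA_bound hα₂ (-1) hC'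
  have b2 := bgA_bound hα₂ (-1) hC''
  have m : ∀ {g g' : ℝ → ℝ}, (∀ y, HasDerivAt g (g' y) y) → Measurable g := fun h =>
    (continuous_iff_continuousAt.2 fun y => (h y).continuousAt).measurable
  have m2 : ∀ {g g' : ℝ → ℝ}, (∀ y, HasDerivAt g (g' y) y) → Measurable g' := by
    intro g g' hg
    have : g' = deriv g := funext fun y => (hg y).deriv.symm
    rw [this]; exact measurable_deriv g
  have A2 : ∀ y, bgA α₂ (-1) f y = bgA α₁ 1 (bgA α₂ (-1) f) y
      - 1 / α₁ * bgA α₁ 1 (bgA α₂ (-1) f') y := fun y => by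
    rw [← bgA_inv hα₁ 1 d1 b0 b1 y]; ring
  have A2' : ∀ y, bgA α₂ (-1) f' y = bgA α₁ 1 (bgA α₂ (-1) f') y
      - 1 / α₁ * bgA α₁ 1 (bgA α₂ (-1) f'') y := fun y => by
    rw [← bgA_inv hα₁ 1 d2 b1 b2 y]; ring
  have F : ∀ y, f y = bgA α₂ (-1) f y + 1 / α₂ * bgA α₂ (-1) f' y := fun y => by
    rw [← bgA_inv hα₂ (-1) hf hC hC' y]; ring
  refine ⟨bgA α₁ 1 (bgA α₂ (-1) f), bgA α₁ 1 (bgA α₂ (-1) f'), bgA α₁ 1 (bgA α₂ (-1) f''),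
    bgA_deriv hα₁ 1 d1 b0 b1, bgA_deriv hα₁ 1 d2 b1 b2, bgA_bound hα₁ 1 b0,
    bgA_bound hα₁ 1 b1, bgA_bound hα₁ 1 b2, fun y => ?_, A2, fun y => ?_⟩
  · rw [← bgA_lin hα₁ 1 (m d1) (m d2) b0 b1, ← funext F]
  · rw [F, A2, A2']
    field_simp
    ring

lemma bg_law {Ω : Type*} [MeasurableSpace Ω] (P : Measure Ω) [IsProbabilityMeasure P]
    {X₁ X₂ : Ω → ℝ} (hX₁ : Measurable X₁) (hX₂ : Measurable X₂)
    {α₁ α₂ p₁ p₂ : ℝ} (hα₁ : 0 < α₁) (hα₂ : 0 < α₂) (hp₁ : 0 < p₁) (hp₂ : 0 < p₂)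
    (hindep : IndepFun X₁ X₂ P)
    (hlaw₁ : P.map X₁ = gammaMeasure p₁ α₁)
    (hlaw₂ : P.map X₂ = gammaMeasure p₂ α₂) :
    Integrable (fun ω => X₁ ω - X₂ ω) P ∧ ∫ ω, (X₁ ω - X₂ ω) ∂P = p₁ / α₁ - p₂ / α₂ ∧
    ∀ s : ℝ, ∫ ω, Complex.exp ((s * (X₁ ω - X₂ ω) : ℝ) * Complex.I) ∂P =
      (1 - ((s / α₁ : ℝ) : ℂ) * Complex.I) ^ (-(p₁ : ℂ)) *
      (1 - ((-s / α₂ : ℝ) : ℂ) * Complex.I) ^ (-(p₂ : ℂ)) := by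
  have m1 := bg_gamma_mean hp₁ hα₁
  have m2 := bg_gamma_mean hp₂ hα₂
  rw [← hlaw₁] at m1
  rw [← hlaw₂] at m2
  have j1 : Integrable X₁ P := (integrable_map_measure (f := X₁) (g := fun x : ℝ => x) (by fun_prop) (by fun_prop)).1 m1.1
  have j2 : Integrable X₂ P := (integrable_map_measure (f := X₂) (g := fun x : ℝ => x) (by fun_prop) (by fun_prop)).1 m2.1
  have k1 : ∫ ω, X₁ ω ∂P = p₁ / α₁ := by
    rw [← m1.2, integral_map (by fun_prop) (by fun_prop)]
  have k2 : ∫ ω, X₂ ω ∂P = p₂ / α₂ := by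
    rw [← m2.2, integral_map (by fun_prop) (by fun_prop)]
  refine ⟨j1.sub j2, by rw [integral_sub j1 j2, k1, k2], fun s => ?_⟩
  have c1 : ∫ ω, Complex.exp ((s * Complex.I) * (X₁ ω : ℝ)) ∂P
      = (1 - (s * Complex.I) / α₁) ^ (-(p₁ : ℂ)) := by
    rw [← bg_gamma_cexp hp₁ hα₁ (by simpa using hα₁), ← hlaw₁, integral_map (by fun_prop)]
    apply Measurable.aestronglyMeasurable; fun_prop
  have c2 : ∫ ω, Complex.exp ((-s * Complex.I) * (X₂ ω : ℝ)) ∂P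
      = (1 - (-s * Complex.I) / α₂) ^ (-(p₂ : ℂ)) := by
    rw [← bg_gamma_cexp hp₂ hα₂ (by simpa using hα₂), ← hlaw₂, integral_map (by fun_prop)]
    apply Measurable.aestronglyMeasurable; fun_prop
  have hi : IndepFun (fun ω => Complex.exp ((s * Complex.I) * (X₁ ω : ℝ)))
      (fun ω => Complex.exp ((-s * Complex.I) * (X₂ ω : ℝ))) P :=
    hindep.comp (φ := fun x : ℝ => Complex.exp ((s * Complex.I) * x))
      (ψ := fun x : ℝ => Complex.exp ((-s * Complex.I) * x)) (by fun_prop) (by fun_prop)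
  have hmul := hi.integral_fun_mul_eq_mul_integral
    (Measurable.aestronglyMeasurable (by fun_prop)) (Measurable.aestronglyMeasurable (by fun_prop))
  rw [c1, c2] at hmul
  have t1 : (s * Complex.I) / α₁ = ((s / α₁ : ℝ) : ℂ) * Complex.I := by push_cast; ring
  have t2 : (-s * Complex.I) / α₂ = ((-s / α₂ : ℝ) : ℂ) * Complex.I := by push_cast; ring
  rw [t1, t2] at hmul
  rw [← hmul]
  refine integral_congr_ae (Filter.Eventually.of_forall fun ω => ?_)
  simp only []
  rw [← Complex.exp_add]
  congr 1
  push_cast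
  ring

lemma bg_avg_bound {N : Measure (ℝ × ℝ)} [IsProbabilityMeasure N]
    (h01 : ∀ᵐ q ∂N, 0 ≤ q.1 ∧ q.1 ≤ 1) (hmom : ∀ k : ℕ, ∫ q, q.1 ^ k ∂N = 1 / (k + 1))
    (k : ℕ) {g : ℝ → ℝ} (hg : ∀ y, |g y| ≤ 1) (y : ℝ) :
    |∫ q, q.1 ^ k * g (q.1 * y + q.2) ∂N| ≤ 1 / (k + 1) := by
  rw [← hmom k, ← Real.norm_eq_abs]
  refine norm_integral_le_of_norm_le ?_ ?_
  · refine bg_intR N (by fun_prop) 1 ?_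
    filter_upwards [h01] with q hq
    rw [abs_of_nonneg (pow_nonneg hq.1 k)]
    exact pow_le_one₀ hq.1 hq.2
  · filter_upwards [h01] with q hq
    rw [norm_mul, Real.norm_eq_abs, Real.norm_eq_abs, abs_of_nonneg (pow_nonneg hq.1 k)]
    exact mul_le_of_le_one_right (pow_nonneg hq.1 k) (hg _)

lemma bg_real_stein {p₁ p₂ α₁ α₂ : ℝ} (hα₁ : 0 < α₁) (hα₂ : 0 < α₂) (hp₁ : 0 < p₁) (hp₂ : 0 < p₂)
    {μ : Measure ℝ} [IsProbabilityMeasure μ] (hμ : Integrable (fun x : ℝ => x) μ)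
    (hμm : ∫ x, x ∂μ = p₁ / α₁ - p₂ / α₂)
    (hμc : ∀ s : ℝ, ∫ x : ℝ, Complex.exp ((s * x : ℝ) * Complex.I) ∂μ =
      (1 - ((s / α₁ : ℝ) : ℂ) * Complex.I) ^ (-(p₁ : ℂ)) *
      (1 - ((-s / α₂ : ℝ) : ℂ) * Complex.I) ^ (-(p₂ : ℂ)))
    {h h1 h2 h3 : ℝ → ℝ} (d0 : ∀ x, HasDerivAt h (h1 x) x) (d1 : ∀ x, HasDerivAt h1 (h2 x) x)
    (d2 : ∀ x, HasDerivAt h2 (h3 x) x) (b0 : ∀ x, |h x| ≤ 1) (b1 : ∀ x, |h1 x| ≤ 1)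
    (b2 : ∀ x, |h2 x| ≤ 1) (b3 : ∀ x, |h3 x| ≤ 1) :
    ∃ f f' f'' : ℝ → ℝ, (∀ y, HasDerivAt f (f' y) y) ∧ (∀ y, HasDerivAt f' (f'' y) y) ∧
      (∀ y, |f y| ≤ 1) ∧ (∀ y, |f' y| ≤ 1 / 2) ∧ (∀ y, |f'' y| ≤ 1 / 3) ∧
      ∀ x, - (x * f x) + p₁ / α₁ * bgA α₁ 1 f x - p₂ / α₂ * bgA α₂ (-1) f x
        = h x - ∫ ξ, h ξ ∂μ := by
  obtain ⟨N, iN, h01, hmom, hN⟩ := bg_exists_N p₁ p₂ α₁ α₂ hp₁ hp₂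
  have i1 := isProbabilityMeasure_gammaMeasure one_pos hα₁
  have i2 := isProbabilityMeasure_gammaMeasure one_pos hα₂
  have hpow : ∀ k : ℕ, ∀ᵐ q ∂N, |q.1 ^ k| ≤ 1 := fun k => by
    filter_upwards [h01] with q hq
    rw [abs_of_nonneg (pow_nonneg hq.1 k)]
    exact pow_le_one₀ hq.1 hq.2
  have hab : ∀ᵐ q ∂N, |q.1| ≤ 1 := by simpa using hpow 1
  have e0 := fun y => (bg_avg N (w := fun q => q.1 ^ 0) (a := fun q => q.1) (b := fun q => q.2)
    (by fun_prop) (by fun_prop) (by fun_prop) (hpow 0) hab d1 b1 b2 y).neg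
  have e1 := fun y => (bg_avg N (w := fun q => q.1 ^ 1) (a := fun q => q.1) (b := fun q => q.2)
    (by fun_prop) (by fun_prop) (by fun_prop) (hpow 1) hab d2 b2 b3 y).neg
  simp only [← pow_succ, zero_add, Nat.reduceAdd] at e0 e1
  have c0 := bg_avg_bound h01 hmom 0 b1
  have c1 := bg_avg_bound h01 hmom 1 b2
  have c2 := bg_avg_bound h01 hmom 2 b3
  refine ⟨fun y => -∫ q, q.1 ^ 0 * h1 (q.1 * y + q.2) ∂N,
    fun y => -∫ q, q.1 ^ 1 * h2 (q.1 * y + q.2) ∂N,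
    fun y => -∫ q, q.1 ^ 2 * h3 (q.1 * y + q.2) ∂N, e0, e1, fun y => ?_, fun y => ?_, fun y => ?_, ?_⟩
  · rw [abs_neg]; exact (c0 y).trans (by norm_num)
  · rw [abs_neg]; exact (c1 y).trans (by norm_num)
  · rw [abs_neg]; exact (c2 y).trans (by norm_num)
  intro x
  have hcont : Continuous h := continuous_iff_continuousAt.2 fun y => (d0 y).continuousAt
  have hcont1 : Continuous h1 := continuous_iff_continuousAt.2 fun y => (d1 y).continuousAt
  have S := bg_stein hα₁ hα₂ hN hμ hμm hμc x (h := fun y => (h y : ℂ)) (ψ := fun y => (h1 y : ℂ))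
    (fun y => (d0 y).ofReal_comp) (by fun_prop) 1
    (fun y => by rw [Complex.norm_real]; exact b1 y)
    (bg_intble μ (by fun_prop) 1 (fun y => by rw [Complex.norm_real]; exact b0 y))
  simp only [← Complex.ofReal_mul] at S
  simp only [integral_complex_ofReal] at S
  norm_cast at S
  simp only [integral_const_mul] at S
  have iP : ∀ (α σ : ℝ), 0 < α → ∫ q : (ℝ × ℝ) × ℝ, h1 (q.1.1 * (x + σ * q.2) + q.1.2)
      ∂(N.prod (gammaMeasure 1 α)) = ∫ u, ∫ q, h1 (q.1 * (x + σ * u) + q.2) ∂N ∂(gammaMeasure 1 α) := by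
    intro α σ hα
    have i1 := isProbabilityMeasure_gammaMeasure one_pos hα
    rw [integral_prod_symm]
    exact bg_intR _ (by fun_prop) 1 (Filter.Eventually.of_forall fun q => b1 _)
  have P1 := iP α₁ 1 hα₁
  have P2 := iP α₂ (-1) hα₂
  simp only [one_mul, neg_one_mul, ← sub_eq_add_neg] at P1 P2
  rw [P1, P2] at S
  simp only [bgA, pow_zero, one_mul, neg_one_mul, ← sub_eq_add_neg, integral_neg]
  linear_combination S

lemma bg_core {Ω : Type*} [MeasurableSpace Ω]
    (P : Measure Ω) [IsProbabilityMeasure P]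
    (G Γ₂ Γ₃ : Ω → ℝ) (hGmeas : Measurable G)
    (hintG : Integrable G P) (hintΓ₂ : Integrable Γ₂ P) (hintΓ₃ : Integrable Γ₃ P)
    (hIBP₁ : ∀ g : ℝ → ℝ, Differentiable ℝ g → (∃ C, ∀ x, |deriv g x| ≤ C) →
      ∫ ω, G ω * g (G ω) ∂P
        = (∫ ω, G ω ∂P) * (∫ ω, g (G ω) ∂P) + ∫ ω, deriv g (G ω) * Γ₂ ω ∂P)
    (hIBP₂ : ∀ g : ℝ → ℝ, Differentiable ℝ g → (∃ C, ∀ x, |deriv g x| ≤ C) →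
      ∫ ω, Γ₂ ω * g (G ω) ∂P
        = (∫ ω, Γ₂ ω ∂P) * (∫ ω, g (G ω) ∂P) + ∫ ω, deriv g (G ω) * Γ₃ ω ∂P)
    (α₁ α₂ p₁ p₂ c : ℝ) (hα₁ : 0 < α₁) (hα₂ : 0 < α₂)
    {h W W' W'' : ℝ → ℝ} (dW : ∀ y, HasDerivAt W (W' y) y) (dW' : ∀ y, HasDerivAt W' (W'' y) y)
    (bW : ∀ y, |W y| ≤ 1) (bW' : ∀ y, |W' y| ≤ 1 / 2) (bW'' : ∀ y, |W'' y| ≤ 1 / 3)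
    (S : ∀ x, - (x * (W x - (1 / α₁ - 1 / α₂) * W' x - 1 / (α₁ * α₂) * W'' x))
      + p₁ / α₁ * (W x + 1 / α₂ * W' x) - p₂ / α₂ * (W x - 1 / α₁ * W' x) = h x - c)
    (hh : Integrable (fun ω => h (G ω)) P) :
    |∫ ω, h (G ω) ∂P - c| ≤
      1 / 3 * ∫ ω, |G ω / (α₁ * α₂) + (1 / α₁ - 1 / α₂) * Γ₂ ω - Γ₃ ω| ∂P
      + 1 / 2 * |(p₁ + p₂) / (α₁ * α₂) + (1 / α₁ - 1 / α₂) * (∫ ω, G ω ∂P) - ∫ ω, Γ₂ ω ∂P|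
      + |(p₁ / α₁ - p₂ / α₂) - ∫ ω, G ω ∂P| := by
  have mW : Measurable W := (continuous_iff_continuousAt.2 fun y => (dW y).continuousAt).measurable
  have mW' : Measurable W' := (continuous_iff_continuousAt.2 fun y => (dW' y).continuousAt).measurable
  have eW' : deriv W = W' := funext fun y => (dW y).deriv
  have eW'' : deriv W' = W'' := funext fun y => (dW' y).deriv
  have mW'' : Measurable W'' := by rw [← eW'']; exact measurable_deriv W'
  have A := hIBP₁ W (fun y => (dW y).differentiableAt) ⟨1 / 2, by rw [eW']; exact bW'⟩
  have B := hIBP₁ W' (fun y => (dW' y).differentiableAt) ⟨1 / 3, by rw [eW'']; exact bW''⟩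
  have D := hIBP₂ W' (fun y => (dW' y).differentiableAt) ⟨1 / 3, by rw [eW'']; exact bW''⟩
  rw [eW'] at A
  rw [eW''] at B D
  have key : ∀ (g : ℝ → ℝ) (C : ℝ) (Y : Ω → ℝ), Measurable g → (∀ y, |g y| ≤ C) → Integrable Y P →
      Integrable (fun ω => Y ω * g (G ω)) P := by
    intro g C Y hg hC hY
    refine Integrable.mul_bdd (c := C) hY ?_ ?_
    · apply Measurable.aestronglyMeasurable; fun_prop
    · exact Filter.Eventually.of_forall fun u => hC _
  have key1 : ∀ (g : ℝ → ℝ) (C : ℝ), Measurable g → (∀ y, |g y| ≤ C) →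
      Integrable (fun ω => g (G ω)) P := fun g C hg hC =>
    bg_intR P (by fun_prop) C (Filter.Eventually.of_forall fun u => hC _)
  have iW := key1 W _ mW bW
  have iW' := key1 W' _ mW' bW'
  have iGW := key W _ G mW bW hintG
  have iGW' := key W' _ G mW' bW' hintG
  have iGW'' := key W'' _ G mW'' bW'' hintG
  have i2W'' := key W'' _ Γ₂ mW'' bW'' hintΓ₂
  have i3W'' := key W'' _ Γ₃ mW'' bW'' hintΓ₃
  simp only [mul_comm (W' _) (Γ₂ _)] at A
  simp only [mul_comm (W'' _) _] at B D
  set Z : Ω → ℝ := fun ω => G ω / (α₁ * α₂) + (1 / α₁ - 1 / α₂) * Γ₂ ω - Γ₃ ω with hZ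
  have iZ : Integrable Z P := ((hintG.div_const _).add (hintΓ₂.const_mul _)).sub hintΓ₃
  have E1 : ∫ ω, h (G ω) ∂P - c = -(∫ ω, G ω * W (G ω) ∂P) + (1 / α₁ - 1 / α₂) * (∫ ω, G ω * W' (G ω) ∂P)
      + 1 / (α₁ * α₂) * (∫ ω, G ω * W'' (G ω) ∂P) + (p₁ / α₁ - p₂ / α₂) * (∫ ω, W (G ω) ∂P)
      + (p₁ + p₂) / (α₁ * α₂) * (∫ ω, W' (G ω) ∂P) := by
    have : ∫ ω, h (G ω) ∂P - c = ∫ ω, (h (G ω) - c) ∂P := by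
      rw [integral_sub hh (integrable_const _)]; simp
    have a1 : Integrable (fun ω => -(G ω * W (G ω))) P := iGW.neg
    have a2 : Integrable (fun ω => -(G ω * W (G ω)) + (1 / α₁ - 1 / α₂) * (G ω * W' (G ω))) P :=
      a1.add (iGW'.const_mul _)
    have a3 : Integrable (fun ω => -(G ω * W (G ω)) + (1 / α₁ - 1 / α₂) * (G ω * W' (G ω))
      + 1 / (α₁ * α₂) * (G ω * W'' (G ω))) P := a2.add (iGW''.const_mul _)
    have a4 : Integrable (fun ω => -(G ω * W (G ω)) + (1 / α₁ - 1 / α₂) * (G ω * W' (G ω))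
      + 1 / (α₁ * α₂) * (G ω * W'' (G ω)) + (p₁ / α₁ - p₂ / α₂) * W (G ω)) P :=
      a3.add (iW.const_mul _)
    rw [this, ← integral_neg, ← integral_const_mul, ← integral_const_mul, ← integral_const_mul,
      ← integral_const_mul, ← integral_add a1 (iGW'.const_mul _),
      ← integral_add a2 (iGW''.const_mul _), ← integral_add a3 (iW.const_mul _),
      ← integral_add a4 (iW'.const_mul _)]
    refine integral_congr_ae (Filter.Eventually.of_forall fun ω => ?_)
    simp only []
    rw [← S (G ω)]
    field_simp
    ring
  have E2 : ∫ ω, Z ω * W'' (G ω) ∂P = 1 / (α₁ * α₂) * (∫ ω, G ω * W'' (G ω) ∂P)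
      + (1 / α₁ - 1 / α₂) * (∫ ω, Γ₂ ω * W'' (G ω) ∂P) - ∫ ω, Γ₃ ω * W'' (G ω) ∂P := by
    have a1 : Integrable (fun ω => 1 / (α₁ * α₂) * (G ω * W'' (G ω))
      + (1 / α₁ - 1 / α₂) * (Γ₂ ω * W'' (G ω))) P := (iGW''.const_mul _).add (i2W''.const_mul _)
    rw [← integral_const_mul, ← integral_const_mul, ← integral_add (iGW''.const_mul _) (i2W''.const_mul _),
      ← integral_sub a1 i3W'']
    refine integral_congr_ae (Filter.Eventually.of_forall fun ω => ?_)
    simp only [hZ]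
    ring
  have E3 : ∫ ω, h (G ω) ∂P - c = ∫ ω, Z ω * W'' (G ω) ∂P
      + ((p₁ + p₂) / (α₁ * α₂) + (1 / α₁ - 1 / α₂) * (∫ ω, G ω ∂P) - ∫ ω, Γ₂ ω ∂P)
        * (∫ ω, W' (G ω) ∂P)
      + ((p₁ / α₁ - p₂ / α₂) - ∫ ω, G ω ∂P) * (∫ ω, W (G ω) ∂P) := by
    rw [E1, E2]
    linear_combination -A + (1 / α₁ - 1 / α₂) * B - D
  have nb : ∀ (g : ℝ → ℝ) (C : ℝ), (∀ y, |g y| ≤ C) → |∫ ω, g (G ω) ∂P| ≤ C := by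
    intro g C hC
    have := norm_integral_le_of_norm_le_const (μ := P) (C := C)
      (f := fun ω => g (G ω)) (Filter.Eventually.of_forall fun u => hC _)
    simpa using this
  have n1 := nb W _ bW
  have n2 := nb W' _ bW'
  have n3 : |∫ ω, Z ω * W'' (G ω) ∂P| ≤ 1 / 3 * ∫ ω, |Z ω| ∂P := by
    rw [← integral_const_mul, ← Real.norm_eq_abs]
    refine norm_integral_le_of_norm_le (iZ.abs.const_mul _) (Filter.Eventually.of_forall fun ω => ?_)
    rw [norm_mul, Real.norm_eq_abs, Real.norm_eq_abs, mul_comm]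
    exact mul_le_mul_of_nonneg_right (bW'' _) (abs_nonneg _)
  rw [E3]
  refine (abs_add_le _ _).trans (add_le_add ((abs_add_le _ _).trans (add_le_add n3 ?_)) ?_)
  · rw [abs_mul, mul_comm]
    exact mul_le_mul_of_nonneg_right n2 (abs_nonneg _)
  · rw [abs_mul]
    exact mul_le_of_le_one_right (abs_nonneg _) n1


/-- **Bilateral gamma approximation bound in terms of Gamma-operators.**
Let `G ∈ D^{2,4}` with Gamma-operators `Γ₂, Γ₃` (the Malliavin integration by parts formulas
for `(G, Γ₂)` and `(Γ₂, Γ₃)` are assumed as hypotheses), and let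
`X = X₁ - X₂ ~ BG(α₁, p₁, α₂, p₂)` with `α₁α₂ > 1 + |α₁ - α₂|`.  With
`α₁₂ = α₁α₂/(α₁α₂ - (1+|α₁-α₂|))` and `α₁₃ = 1/α₁ - 1/α₂`,
`d₃(G,X) ≤ (α₁₂/3) E|G/(α₁α₂) + α₁₃Γ₂ - Γ₃| + (α₁₂/2)|(p₁+p₂)/(α₁α₂) + α₁₃E(G) - E(Γ₂)|`
`+ α₁₂ |E(X) - E(G)|`. -/
theorem bg_approximation_bound {Ω : Type*} [MeasurableSpace Ω]
    (P : Measure Ω) [IsProbabilityMeasure P]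
    (G Γ₂ Γ₃ : Ω → ℝ) (hGmeas : Measurable G)
    (hintG : Integrable G P) (hintΓ₂ : Integrable Γ₂ P) (hintΓ₃ : Integrable Γ₃ P)
    (hIBP₁ : ∀ g : ℝ → ℝ, Differentiable ℝ g → (∃ C, ∀ x, |deriv g x| ≤ C) →
      ∫ ω, G ω * g (G ω) ∂P
        = (∫ ω, G ω ∂P) * (∫ ω, g (G ω) ∂P) + ∫ ω, deriv g (G ω) * Γ₂ ω ∂P)
    (hIBP₂ : ∀ g : ℝ → ℝ, Differentiable ℝ g → (∃ C, ∀ x, |deriv g x| ≤ C) →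
      ∫ ω, Γ₂ ω * g (G ω) ∂P
        = (∫ ω, Γ₂ ω ∂P) * (∫ ω, g (G ω) ∂P) + ∫ ω, deriv g (G ω) * Γ₃ ω ∂P)
    (X₁ X₂ : Ω → ℝ) (hX₁ : Measurable X₁) (hX₂ : Measurable X₂)
    (α₁ α₂ p₁ p₂ : ℝ) (hα₁ : 0 < α₁) (hα₂ : 0 < α₂) (hp₁ : 0 < p₁) (hp₂ : 0 < p₂)
    (hcond : 1 + |α₁ - α₂| < α₁ * α₂)
    (hindep : IndepFun X₁ X₂ P)
    (hlaw₁ : P.map X₁ = gammaMeasure p₁ α₁)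
    (hlaw₂ : P.map X₂ = gammaMeasure p₂ α₂) :
    dSmooth P G (fun ω => X₁ ω - X₂ ω) 3
      ≤ (α₁ * α₂ / (α₁ * α₂ - (1 + |α₁ - α₂|))) / 3
          * ∫ ω, |G ω / (α₁ * α₂) + (1 / α₁ - 1 / α₂) * Γ₂ ω - Γ₃ ω| ∂P
        + (α₁ * α₂ / (α₁ * α₂ - (1 + |α₁ - α₂|))) / 2
          * |(p₁ + p₂) / (α₁ * α₂) + (1 / α₁ - 1 / α₂) * (∫ ω, G ω ∂P) - ∫ ω, Γ₂ ω ∂P|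
        + (α₁ * α₂ / (α₁ * α₂ - (1 + |α₁ - α₂|)))
          * |(∫ ω, (X₁ ω - X₂ ω) ∂P) - ∫ ω, G ω ∂P| := by
  obtain ⟨jX, mX, cX⟩ := bg_law P hX₁ hX₂ hα₁ hα₂ hp₁ hp₂ hindep hlaw₁ hlaw₂
  have hXm : Measurable (fun ω => X₁ ω - X₂ ω) := hX₁.sub hX₂
  set μ := P.map (fun ω => X₁ ω - X₂ ω) with hμ
  have iμ : IsProbabilityMeasure μ := Measure.isProbabilityMeasure_map hXm.aemeasurable
  have hpos : 0 < α₁ * α₂ - (1 + |α₁ - α₂|) := by linarith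
  have hone : 1 ≤ α₁ * α₂ / (α₁ * α₂ - (1 + |α₁ - α₂|)) := by
    rw [le_div_iff₀ hpos]
    linarith [abs_nonneg (α₁ - α₂)]
  set K := α₁ * α₂ / (α₁ * α₂ - (1 + |α₁ - α₂|)) with hK
  have hI : 0 ≤ ∫ ω, |G ω / (α₁ * α₂) + (1 / α₁ - 1 / α₂) * Γ₂ ω - Γ₃ ω| ∂P :=
    integral_nonneg fun ω => abs_nonneg _
  have hK0 : 0 ≤ K := by linarith
  refine Real.sSup_le ?_ (by positivity)
  rintro d ⟨h, ⟨hd, hb⟩, rfl⟩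
  have d0 : ∀ x, HasDerivAt h (iteratedDeriv 1 h x) x := fun x => by
    have := (hd 0 (by norm_num) x).hasDerivAt
    rw [← iteratedDeriv_succ, iteratedDeriv_zero] at this
    exact this
  have d1 : ∀ x, HasDerivAt (iteratedDeriv 1 h) (iteratedDeriv 2 h x) x := fun x => by
    have := (hd 1 (by norm_num) x).hasDerivAt
    rw [← iteratedDeriv_succ] at this
    exact this
  have d2 : ∀ x, HasDerivAt (iteratedDeriv 2 h) (iteratedDeriv 3 h x) x := fun x => by
    have := (hd 2 (by norm_num) x).hasDerivAt
    rw [← iteratedDeriv_succ] at this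
    exact this
  have b0 : ∀ x, |h x| ≤ 1 := fun x => by simpa using hb 0 (by norm_num) x
  have hcont : Continuous h := continuous_iff_continuousAt.2 fun y => (d0 y).continuousAt
  obtain ⟨f, f', f'', e0, e1, c0, c1, c2, S⟩ := bg_real_stein (μ := μ) hα₁ hα₂ hp₁ hp₂
    ((integrable_map_measure (f := fun ω => X₁ ω - X₂ ω) (g := fun x : ℝ => x) (by fun_prop)
      hXm.aemeasurable).2 jX)
    (by rw [← mX, hμ, integral_map hXm.aemeasurable (by fun_prop)])
    (fun s => by
      rw [← cX, hμ, integral_map hXm.aemeasurable]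
      apply Measurable.aestronglyMeasurable; fun_prop)
    d0 d1 d2 b0 (hb 1 (by norm_num)) (hb 2 (by norm_num)) (hb 3 (by norm_num))
  have hX : ∫ ξ, h ξ ∂μ = ∫ ω, h (X₁ ω - X₂ ω) ∂P := by
    rw [hμ, integral_map hXm.aemeasurable hcont.aestronglyMeasurable]
  obtain ⟨W, W', W'', dW, dW', bW, bW', bW'', q1, q2, q3⟩ := bg_W hα₁ hα₂ e0 e1 c0 c1 c2
  simp only [q1, q2, q3, hX] at S
  have R := bg_core P G Γ₂ Γ₃ hGmeas hintG hintΓ₂ hintΓ₃ hIBP₁ hIBP₂ α₁ α₂ p₁ p₂ _ hα₁ hα₂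
    dW dW' bW bW' bW'' S
    (bg_intR P (by fun_prop) 1 (Filter.Eventually.of_forall fun ω => b0 _))
  rw [← mX] at R
  refine R.trans ?_
  have u1 := mul_le_mul_of_nonneg_right hone hI
  have u2 := mul_le_mul_of_nonneg_right hone (abs_nonneg
    ((p₁ + p₂) / (α₁ * α₂) + (1 / α₁ - 1 / α₂) * (∫ ω, G ω ∂P) - ∫ ω, Γ₂ ω ∂P))
  have u3 := mul_le_mul_of_nonneg_right hone (abs_nonneg
    ((∫ ω, (X₁ ω - X₂ ω) ∂P) - ∫ ω, G ω ∂P))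
  linarith
end
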